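/- Let (V, μ, R) be a braided algebra over a commutative ring k. Then for every linear map f : V → V the four components of the Yang–Baxter Hochschild second differential vanish on δ¹ of f: δ²_YB(δ¹_YB(f)) = 0, δ²_YI(δ¹_YB(f), δ¹_H(f)) = 0, δ²_IY(δ¹_YB(f), δ¹_H(f)) = 0, and δ²_H(δ¹_H(f)) = 0. In other words, C¹_YBH → C²_YBH → C³_YBH with the differentials δ¹_YBH = δ¹_YB ⊕ δ¹_H and δ²_YBH = δ²_YB ⊕ δ²_YI ⊕ δ²_IY ⊕ δ²_H is a cochain complex. -/

import Mathlib

open TensorProduct LinearMap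

noncomputable section

variable {k : Type*} [CommRing k] {V : Type*} [AddCommGroup V] [Module k V]

/-- `g ⊗ 1` acting on `(V ⊗ V) ⊗ V`, for `g : V ⊗ V → V ⊗ V`. -/
def rT2 (g : V ⊗[k] V →ₗ[k] V ⊗[k] V) :
    (V ⊗[k] V) ⊗[k] V →ₗ[k] (V ⊗[k] V) ⊗[k] V :=
  g.rTensor V

/-- `1 ⊗ g` acting on `(V ⊗ V) ⊗ V`, for `g : V ⊗ V → V ⊗ V`. -/
def lT2 (g : V ⊗[k] V →ₗ[k] V ⊗[k] V) :
    (V ⊗[k] V) ⊗[k] V →ₗ[k] (V ⊗[k] V) ⊗[k] V :=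
  (TensorProduct.assoc k V V V).symm.toLinearMap ∘ₗ g.lTensor V ∘ₗ
    (TensorProduct.assoc k V V V).toLinearMap

/-- `h ⊗ 1 : V ⊗ V ⊗ V → V ⊗ V`, for `h : V ⊗ V → V`. -/
def rT21 (h : V ⊗[k] V →ₗ[k] V) :
    (V ⊗[k] V) ⊗[k] V →ₗ[k] V ⊗[k] V :=
  h.rTensor V

/-- `1 ⊗ h : V ⊗ V ⊗ V → V ⊗ V`, for `h : V ⊗ V → V`. -/
def lT21 (h : V ⊗[k] V →ₗ[k] V) :
    (V ⊗[k] V) ⊗[k] V →ₗ[k] V ⊗[k] V :=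
  h.lTensor V ∘ₗ (TensorProduct.assoc k V V V).toLinearMap

/-- first Hochschild differential -/
def d1H (μ : V ⊗[k] V →ₗ[k] V) (f : V →ₗ[k] V) : V ⊗[k] V →ₗ[k] V :=
  μ ∘ₗ f.rTensor V + μ ∘ₗ f.lTensor V - f ∘ₗ μ

/-- first Yang-Baxter differential -/
def d1YB (R : V ⊗[k] V →ₗ[k] V ⊗[k] V) (f : V →ₗ[k] V) :
    V ⊗[k] V →ₗ[k] V ⊗[k] V :=
  R ∘ₗ f.rTensor V + R ∘ₗ f.lTensor V - f.rTensor V ∘ₗ R - f.lTensor V ∘ₗ R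

/-- second Hochschild differential -/
def d2H (μ : V ⊗[k] V →ₗ[k] V) (ψ : V ⊗[k] V →ₗ[k] V) :
    (V ⊗[k] V) ⊗[k] V →ₗ[k] V :=
  μ ∘ₗ rT21 ψ + ψ ∘ₗ rT21 μ - μ ∘ₗ lT21 ψ - ψ ∘ₗ lT21 μ

/-- second Yang-Baxter differential -/
def d2YB (R φ : V ⊗[k] V →ₗ[k] V ⊗[k] V) :
    (V ⊗[k] V) ⊗[k] V →ₗ[k] (V ⊗[k] V) ⊗[k] V :=
  rT2 R ∘ₗ lT2 R ∘ₗ rT2 φ + rT2 R ∘ₗ lT2 φ ∘ₗ rT2 R + rT2 φ ∘ₗ lT2 R ∘ₗ rT2 R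
    - lT2 R ∘ₗ rT2 R ∘ₗ lT2 φ - lT2 R ∘ₗ rT2 φ ∘ₗ lT2 R - lT2 φ ∘ₗ rT2 R ∘ₗ lT2 R

/-- YI component of the second Yang-Baxter Hochschild differential -/
def d2YI (μ : V ⊗[k] V →ₗ[k] V) (R φ : V ⊗[k] V →ₗ[k] V ⊗[k] V)
    (ψ : V ⊗[k] V →ₗ[k] V) : (V ⊗[k] V) ⊗[k] V →ₗ[k] V ⊗[k] V :=
  lT21 ψ ∘ₗ rT2 R ∘ₗ lT2 R + lT21 μ ∘ₗ rT2 φ ∘ₗ lT2 R + lT21 μ ∘ₗ rT2 R ∘ₗ lT2 φ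
    - R ∘ₗ rT21 ψ - φ ∘ₗ rT21 μ

/-- IY component of the second Yang-Baxter Hochschild differential -/
def d2IY (μ : V ⊗[k] V →ₗ[k] V) (R φ : V ⊗[k] V →ₗ[k] V ⊗[k] V)
    (ψ : V ⊗[k] V →ₗ[k] V) : (V ⊗[k] V) ⊗[k] V →ₗ[k] V ⊗[k] V :=
  rT21 ψ ∘ₗ lT2 R ∘ₗ rT2 R + rT21 μ ∘ₗ lT2 φ ∘ₗ rT2 R + rT21 μ ∘ₗ lT2 R ∘ₗ rT2 φ
    - R ∘ₗ lT21 ψ - φ ∘ₗ lT21 μ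

/-- `(V,μ,R)` is a braided algebra. -/
structure IsBraidedAlgebra (μ : V ⊗[k] V →ₗ[k] V)
    (R : V ⊗[k] V →ₗ[k] V ⊗[k] V) : Prop where
  assoc : μ ∘ₗ rT21 μ = μ ∘ₗ lT21 μ
  Rbij : Function.Bijective R
  yb : rT2 R ∘ₗ lT2 R ∘ₗ rT2 R = lT2 R ∘ₗ rT2 R ∘ₗ lT2 R
  yi : lT21 μ ∘ₗ rT2 R ∘ₗ lT2 R = R ∘ₗ rT21 μ
  iy : rT21 μ ∘ₗ lT2 R ∘ₗ rT2 R = R ∘ₗ lT21 μ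

/-- The derivation `f ⊗ 1 + 1 ⊗ f` of `V ⊗ V` induced by `f`. -/
def der2 (f : V →ₗ[k] V) : V ⊗[k] V →ₗ[k] V ⊗[k] V :=
  f.rTensor V + f.lTensor V

/-- The derivation `f ⊗ 1 ⊗ 1 + 1 ⊗ f ⊗ 1 + 1 ⊗ 1 ⊗ f` of `V ⊗ V ⊗ V` induced by `f`. -/
def der3 (f : V →ₗ[k] V) : (V ⊗[k] V) ⊗[k] V →ₗ[k] (V ⊗[k] V) ⊗[k] V :=
  (der2 f).rTensor V + f.lTensor (V ⊗[k] V)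

theorem d1YB_eq (R : V ⊗[k] V →ₗ[k] V ⊗[k] V) (f : V →ₗ[k] V) :
    d1YB R f = R ∘ₗ der2 f - der2 f ∘ₗ R := by
  simp only [d1YB, der2, comp_add, add_comp]
  abel

theorem d1H_eq (μ : V ⊗[k] V →ₗ[k] V) (f : V →ₗ[k] V) :
    d1H μ f = μ ∘ₗ der2 f - f ∘ₗ μ := by
  simp only [d1H, der2, comp_add]

/-- `der3` in terms of the right-bracketed triple tensor product. -/
theorem assoc_comp_der3 (f : V →ₗ[k] V) :
    (TensorProduct.assoc k V V V).toLinearMap ∘ₗ der3 f =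
      (f.rTensor (V ⊗[k] V) + (der2 f).lTensor V) ∘ₗ
        (TensorProduct.assoc k V V V).toLinearMap := by
  ext x y z
  simp [der3, der2, add_assoc]

theorem assoc_der3_apply (f : V →ₗ[k] V) (x : (V ⊗[k] V) ⊗[k] V) :
    TensorProduct.assoc k V V V (der3 f x) =
      f.rTensor (V ⊗[k] V) (TensorProduct.assoc k V V V x) +
        (der2 f).lTensor V (TensorProduct.assoc k V V V x) :=
  LinearMap.congr_fun (assoc_comp_der3 f) x

theorem rTensor_lTensor_comm_apply {M N P Q : Type*} [AddCommGroup M] [Module k M]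
    [AddCommGroup N] [Module k N] [AddCommGroup P] [Module k P] [AddCommGroup Q] [Module k Q]
    (g : M →ₗ[k] N) (h : P →ₗ[k] Q) (x : M ⊗[k] P) :
    g.rTensor Q (h.lTensor M x) = h.lTensor N (g.rTensor P x) := by
  rw [← comp_apply, ← comp_apply, rTensor_comp_lTensor, lTensor_comp_rTensor]

theorem rT2_d1YB (R : V ⊗[k] V →ₗ[k] V ⊗[k] V) (f : V →ₗ[k] V) :
    rT2 (d1YB R f) = rT2 R ∘ₗ der3 f - der3 f ∘ₗ rT2 R := by
  refine LinearMap.ext fun x => ?_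
  simp [d1YB_eq, rT2, der3, rTensor_sub, rTensor_comp, rTensor_lTensor_comm_apply]

theorem lT2_d1YB (R : V ⊗[k] V →ₗ[k] V ⊗[k] V) (f : V →ₗ[k] V) :
    lT2 (d1YB R f) = lT2 R ∘ₗ der3 f - der3 f ∘ₗ lT2 R := by
  refine LinearMap.ext fun x => (TensorProduct.assoc k V V V).injective ?_
  simp [d1YB_eq, lT2, lTensor_sub, lTensor_comp, assoc_der3_apply, rTensor_lTensor_comm_apply]

theorem rT21_d1H (μ : V ⊗[k] V →ₗ[k] V) (f : V →ₗ[k] V) :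
    rT21 (d1H μ f) = rT21 μ ∘ₗ der3 f - der2 f ∘ₗ rT21 μ := by
  refine LinearMap.ext fun x => ?_
  simp [d1H_eq, rT21, der3, der2, rTensor_sub, rTensor_comp, rTensor_lTensor_comm_apply]

theorem lT21_d1H (μ : V ⊗[k] V →ₗ[k] V) (f : V →ₗ[k] V) :
    lT21 (d1H μ f) = lT21 μ ∘ₗ der3 f - der2 f ∘ₗ lT21 μ := by
  refine LinearMap.ext fun x => ?_
  simp only [d1H_eq, lT21, lTensor_sub, lTensor_comp, LinearMap.sub_apply, comp_apply,
    LinearEquiv.coe_coe, assoc_der3_apply, map_add]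
  rw [der2, LinearMap.add_apply, rTensor_lTensor_comm_apply]
  abel

/-- for a braided algebra `(V, μ, R)`, all four components of the
Yang-Baxter Hochschild second differential vanish on `δ¹` of any `f : V → V`,
i.e. `δ²_YBH ∘ δ¹_YBH = 0`. -/
theorem d2YBH_d1YBH_eq_zero {k : Type*} [CommRing k] {V : Type*} [AddCommGroup V]
    [Module k V] (μ : V ⊗[k] V →ₗ[k] V) (R : V ⊗[k] V →ₗ[k] V ⊗[k] V)
    (hBA : IsBraidedAlgebra μ R) (f : V →ₗ[k] V) :
    d2YB R (d1YB R f) = 0 ∧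
    d2YI μ R (d1YB R f) (d1H μ f) = 0 ∧
    d2IY μ R (d1YB R f) (d1H μ f) = 0 ∧
    d2H μ (d1H μ f) = 0 := by
  have assoc x := LinearMap.congr_fun hBA.assoc x
  have yb x := LinearMap.congr_fun hBA.yb x
  have yi x := LinearMap.congr_fun hBA.yi x
  have iy x := LinearMap.congr_fun hBA.iy x
  simp only [comp_apply] at assoc yb yi iy
  refine ⟨?_, ?_, ?_, ?_⟩ <;> refine LinearMap.ext fun x => ?_
  · simp only [d2YB, rT2_d1YB, lT2_d1YB, comp_apply, LinearMap.add_apply, LinearMap.sub_apply,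
      map_sub, LinearMap.zero_apply, yb]
    abel
  · rw [d2YI, rT2_d1YB, lT2_d1YB, lT21_d1H, rT21_d1H, d1YB_eq]
    simp only [comp_apply, LinearMap.add_apply, LinearMap.sub_apply,
      map_sub, LinearMap.zero_apply, yi]
    abel
  · rw [d2IY, rT2_d1YB, lT2_d1YB, lT21_d1H, rT21_d1H, d1YB_eq]
    simp only [comp_apply, LinearMap.add_apply, LinearMap.sub_apply,
      map_sub, LinearMap.zero_apply, iy]
    abel
  · rw [d2H, lT21_d1H, rT21_d1H, d1H_eq]
    simp only [comp_apply, LinearMap.add_apply, LinearMap.sub_apply,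
      map_sub, LinearMap.zero_apply, assoc]
    abel

end
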